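/- arXiv:2205.01658 — 7 statements merged into one kernel-verified Lean document; each statement's English description precedes it below -/
import Mathlib

section
/- Let (R, m) be a local ring with m² ≠ 0. If there exists an element x ∈ m such that m² ⊆ xR, then there exists an element y ∈ m \ m² such that m² ⊆ yR. -/
open IsLocalRing

/-- Let `(R, m)` be a local ring with `m² ≠ 0`.  If there exists an element `x ∈ m`
with `m² ⊆ xR`, then there exists an element `y ∈ m \ m²` with `m² ⊆ yR`. -/
theorem stmt1 {R : Type*} [CommRing R] [IsLocalRing R]
    (hm2 : (maximalIdeal R) ^ 2 ≠ ⊥)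
    (x : R) (hx : x ∈ maximalIdeal R)
    (hxR : (maximalIdeal R) ^ 2 ≤ Ideal.span {x}) :
    ∃ y : R, y ∈ maximalIdeal R ∧ y ∉ (maximalIdeal R) ^ 2 ∧
      (maximalIdeal R) ^ 2 ≤ Ideal.span {y} := by
  by_cases hx2 : x ∈ (maximalIdeal R) ^ 2
  swap
  · exact ⟨x, hx, hx2, hxR⟩
  have key : ∀ z c : R, c ∈ maximalIdeal R → z = c * z → z = 0 := by
    intro z c hc h
    have hu : IsUnit (1 - c) := by
      by_contra hn
      have h1 : (1 - c) + c ∈ maximalIdeal R :=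
        Ideal.add_mem _ ((mem_maximalIdeal _).2 hn) hc
      rw [sub_add_cancel] at h1
      exact (mem_maximalIdeal _).1 h1 isUnit_one
    apply (hu.mul_right_eq_zero).1
    linear_combination h
  have hx0 : x ≠ 0 := by
    rintro rfl
    apply hm2
    rw [eq_bot_iff]
    simpa using hxR
  have hex : ∃ a ∈ maximalIdeal R, ∃ b ∈ maximalIdeal R,
      a * b ∉ maximalIdeal R * Ideal.span {x} := by
    by_contra! hcon
    have hle : (maximalIdeal R) ^ 2 ≤ maximalIdeal R * Ideal.span {x} := by
      rw [pow_two]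
      exact Ideal.mul_le.2 hcon
    obtain ⟨c, hc, hcx⟩ := Ideal.mem_mul_span_singleton.1 (hle hx2)
    exact hx0 (key x c hc hcx.symm)
  obtain ⟨a, ha, b, hb, hab⟩ := hex
  have hab2 : a * b ∈ (maximalIdeal R) ^ 2 := by
    rw [pow_two]
    exact Ideal.mul_mem_mul ha hb
  obtain ⟨r, hr⟩ := Ideal.mem_span_singleton'.1 (hxR hab2)
  have hru : IsUnit r := by
    by_contra hn
    exact hab (Ideal.mem_mul_span_singleton.2 ⟨r, (mem_maximalIdeal _).2 hn, hr⟩)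
  obtain ⟨s, hs⟩ := hru.exists_left_inv
  have hxab : x = s * (a * b) := by
    linear_combination s * hr - x * hs
  refine ⟨a, ha, ?_, ?_⟩
  · intro ha2
    obtain ⟨t, ht⟩ := Ideal.mem_span_singleton'.1 (hxR ha2)
    have ha0 : a = 0 := key a (t * s * b) (Ideal.mul_mem_left _ _ hb) (by
      linear_combination -ht + t * hxab)
    exact hx0 (by rw [hxab, ha0]; ring)
  · refine hxR.trans ?_
    rw [Ideal.span_singleton_le_span_singleton]
    exact ⟨s * b, by rw [hxab]; ring⟩
end

section
/- Let (R, m) be a Noetherian local ring with m² ≠ 0 and ms(R) = n. Then there exist elements y₁, …, yₙ ∈ m \ m² such that m² = (y₁, …, yₙ)·m. -/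
open IsLocalRing

/-- The minimal number of generators of an ideal. -/
noncomputable def mu {R : Type*} [CommRing R] (I : Ideal R) : ℕ :=
  sInf {n : ℕ | ∃ s : Finset R, s.card = n ∧ Ideal.span (s : Set R) = I}

/-- `ms R = min {μ(I) : m² ⊆ I ⊆ m}`. -/
noncomputable def ms (R : Type*) [CommRing R] [IsLocalRing R] : ℕ :=
  sInf {n : ℕ | ∃ I : Ideal R,
    (maximalIdeal R) ^ 2 ≤ I ∧ I ≤ maximalIdeal R ∧ mu I = n}

set_option maxHeartbeats 1000000 in
theorem aux_core {R : Type*} [CommRing R] [IsLocalRing R] [IsNoetherianRing R]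
    (I : Ideal R) (k V : Type*) [Field k] [AddCommGroup V] [Algebra R k] [Module R V] [Module k V]
    [IsScalarTower R k V] (hk : Function.Surjective (algebraMap R k))
    (f : I →ₗ[R] V) (hf : Function.Surjective f)
    (hker : ∀ x : I, f x = 0 → (x : R) ∈ maximalIdeal R * I)
    (h1 : (maximalIdeal R) ^ 2 ≤ I) (h2 : I ≤ maximalIdeal R) :
    ∃ y : Fin (mu I) → R,
      (∀ i, y i ∈ maximalIdeal R ∧ y i ∉ (maximalIdeal R) ^ 2) ∧
      (maximalIdeal R) ^ 2 = Ideal.span (Set.range y) * maximalIdeal R := by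
  classical
  have hj : maximalIdeal R ≤ Ideal.jacobson ⊥ := by
    rw [IsLocalRing.jacobson_eq_maximalIdeal ⊥ bot_ne_top]
  -- transfer lemmas
  have A : ∀ (s : Set I) (x : I), (x : R) ∈ Ideal.span ((↑) '' s : Set R) →
      f x ∈ Submodule.span k (f '' s) := by
    intro s x hx
    have h : x ∈ Submodule.span R s := by
      have h' : (I.subtype x) ∈ (Submodule.span R s).map I.subtype := by
        rw [Submodule.map_span]; exact hx
      obtain ⟨z, hz, hzx⟩ := h'
      rwa [← I.injective_subtype hzx]
    have h3 : f x ∈ (Submodule.span R s).map f := ⟨x, h, rfl⟩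
    rw [Submodule.map_span] at h3
    have := Submodule.restrictScalars_span R k hk (f '' s)
    rw [← this] at h3
    exact h3
  have B : ∀ (s : Set I) (x : I), f x ∈ Submodule.span k (f '' s) →
      (x : R) ∈ Ideal.span ((↑) '' s : Set R) ⊔ maximalIdeal R * I := by
    intro s x hx
    have h3 : f x ∈ Submodule.span R (f '' s) := by
      rw [← Submodule.restrictScalars_span R k hk]; exact hx
    rw [← Submodule.map_span] at h3
    obtain ⟨z, hz, hzx⟩ := h3
    have h4 : (z : R) ∈ Ideal.span ((↑) '' s : Set R) := by
      have : I.subtype z ∈ (Submodule.span R s).map I.subtype := ⟨z, hz, rfl⟩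
      rw [Submodule.map_span] at this; exact this
    have h5 := hker (x - z) (by rw [map_sub, hzx, sub_self])
    have : (x : R) = z + ((x - z : I) : R) := by simp
    rw [this]
    exact add_mem (Ideal.mem_sup_left h4) (Ideal.mem_sup_right h5)
  -- products
  let t : Set I := {x | ∃ a ∈ maximalIdeal R, a ∉ (maximalIdeal R) ^ 2 ∧
    ∃ c ∈ maximalIdeal R, (x : R) = a * c}
  have hm : maximalIdeal R ≤ Ideal.span {a | a ∈ maximalIdeal R ∧ a ∉ (maximalIdeal R) ^ 2} := by
    refine Submodule.le_of_le_smul_of_le_jacobson_bot (IsNoetherian.noetherian _) hj ?_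
    intro x hx
    by_cases hx2 : x ∈ (maximalIdeal R) ^ 2
    · exact Submodule.mem_sup_right (by rwa [smul_eq_mul, ← pow_two])
    · exact Submodule.mem_sup_left (Ideal.subset_span ⟨hx, hx2⟩)
  have ht : (maximalIdeal R) ^ 2 ≤ Ideal.span ((↑) '' t : Set R) := by
    rw [pow_two, Ideal.mul_le]
    intro r hr s hs
    have hr' := hm hr
    induction hr' using Submodule.span_induction with
    | mem x hx =>
      refine Ideal.subset_span ⟨⟨x * s, h1 ?_⟩, ⟨x, hx.1, hx.2, s, hs, rfl⟩, rfl⟩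
      rw [pow_two]; exact Ideal.mul_mem_mul hx.1 hs
    | zero => simp
    | add x y hx hy ihx ihy =>
      rw [add_mul]
      have : Ideal.span {a | a ∈ maximalIdeal R ∧ a ∉ (maximalIdeal R) ^ 2} ≤ maximalIdeal R :=
        Ideal.span_le.2 fun a ha => ha.1
      exact add_mem (ihx (this hx)) (ihy (this hy))
    | smul a x hx ihx =>
      have : Ideal.span {a | a ∈ maximalIdeal R ∧ a ∉ (maximalIdeal R) ^ 2} ≤ maximalIdeal R :=
        Ideal.span_le.2 fun a ha => ha.1
      rw [smul_eq_mul, mul_assoc]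
      exact Ideal.mul_mem_left _ _ (ihx (this hx))
  obtain ⟨b₁, hb₁t, -, hb₁s, hb₁⟩ := exists_linearIndepOn_extension (K := k) (v := f)
    (linearIndepOn_empty k f) (Set.empty_subset t)
  obtain ⟨b, -, hb₁b, hbs, hb⟩ := exists_linearIndepOn_extension (K := k) (v := f)
    hb₁ (Set.subset_univ b₁)
  have hm2 : ∀ x : I, (x : R) ∈ (maximalIdeal R) ^ 2 → f x ∈ Submodule.span k (f '' b₁) := by
    intro x hx
    exact Submodule.span_le.2 hb₁s (A t x (ht hx))
  have hbI : I = Ideal.span ((↑) '' b : Set R) := by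
    apply le_antisymm
    · refine Submodule.le_of_le_smul_of_le_jacobson_bot (IsNoetherian.noetherian _) hj ?_
      intro x hx
      exact B b ⟨x, hx⟩ (hbs ⟨_, trivial, rfl⟩)
    · rw [Ideal.span_le]; rintro _ ⟨x, -, rfl⟩; exact x.2
  -- cardinality
  have hne : {n : ℕ | ∃ s : Finset R, s.card = n ∧ Ideal.span (s : Set R) = I}.Nonempty := by
    obtain ⟨s, hs⟩ := IsNoetherian.noetherian I
    exact ⟨_, s, rfl, hs⟩
  obtain ⟨S, hSc, hS⟩ := Nat.sInf_mem hne
  change S.card = mu I at hSc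
  have hSI : ∀ x ∈ S, x ∈ I := fun x hx => hS ▸ Ideal.subset_span hx
  let w : Finset I := S.attach.image fun x => ⟨x.1, hSI x.1 x.2⟩
  have hw : ((↑) '' (w : Set I) : Set R) = S := by
    ext x; simp [w]
    exact fun h => hSI x h
  have hwc : (w.image f).card ≤ mu I := by
    rw [← hSc, ← S.card_attach]
    exact Finset.card_image_le.trans Finset.card_image_le
  have hwspan : Submodule.span k ((w.image f : Finset V) : Set V) = ⊤ := by
    rw [eq_top_iff]; intro v _
    obtain ⟨x, rfl⟩ := hf v
    rw [Finset.coe_image]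
    apply A
    rw [hw, hS]; exact x.2
  have hle := linearIndependent_le_span_finset _ hb (w.image f) hwspan
  have hfin : Finite b := Cardinal.lt_aleph0_iff_finite.1
    (hle.trans_lt (Cardinal.natCast_lt_aleph0))
  have hle' : Nat.card b ≤ mu I := by
    rw [← Nat.cast_card] at hle
    exact (Nat.cast_le.1 hle).trans hwc
  have hge : mu I ≤ Nat.card b := by
    have hbf : b.Finite := hfin
    have : mu I ≤ (hbf.toFinset.image (Subtype.val : I → R)).card := by
      apply Nat.sInf_le
      refine ⟨_, rfl, ?_⟩
      rw [Finset.coe_image, Set.Finite.coe_toFinset]; exact hbI.symm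
    refine this.trans (Finset.card_image_le.trans ?_)
    rw [Nat.card_coe_set_eq, Set.ncard_eq_toFinset_card b hbf]
  have hcard : Nat.card b = mu I := le_antisymm hle' hge
  -- choice of y
  have hy : ∀ x : b, ∃ y : R, (y ∈ maximalIdeal R ∧ y ∉ (maximalIdeal R) ^ 2) ∧
      ((x : I) : R) ∈ Ideal.span {y} ∧
      ((x : I) ∈ b₁ → ((x : I) : R) ∈ Ideal.span {y} * maximalIdeal R) := by
    rintro ⟨x, hx⟩
    by_cases hx1 : x ∈ b₁
    · obtain ⟨a, ha, ha2, c, hc, hxac⟩ := hb₁t hx1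
      have : (x : R) ∈ Ideal.span {a} * maximalIdeal R := by
        rw [hxac]; exact Ideal.mul_mem_mul (Ideal.mem_span_singleton_self a) hc
      have h6 : (x : R) ∈ Ideal.span {a} := by
        rw [hxac]; exact Ideal.mul_mem_right _ _ (Ideal.mem_span_singleton_self a)
      exact ⟨a, ⟨ha, ha2⟩, h6, fun _ => this⟩
    · refine ⟨x, ⟨h2 x.2, fun hx2 => ?_⟩, Ideal.mem_span_singleton_self _, fun h => absurd h hx1⟩
      exact ((hb₁.notMem_span_iff).2 ⟨hb.mono (Set.insert_subset hx hb₁b), hx1⟩) (hm2 x hx2)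
  choose y hy1 hy2 hy3 using hy
  have hIy : I ≤ Ideal.span (Set.range y) := by
    refine hbI.le.trans (Ideal.span_le.2 ?_)
    rintro _ ⟨x, hx, rfl⟩
    exact Ideal.span_mono (Set.singleton_subset_iff.2 (Set.mem_range_self (f := y) ⟨x, hx⟩)) (hy2 ⟨x, hx⟩)
  let e : Fin (mu I) ≃ b := (finCongr hcard.symm).trans (Finite.equivFin b).symm
  refine ⟨y ∘ e, fun i => hy1 _, ?_⟩
  rw [e.surjective.range_comp]
  apply le_antisymm
  · intro x hx
    have := B b₁ ⟨x, h1 hx⟩ (hm2 _ hx)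
    refine (sup_le (Ideal.span_le.2 ?_) ?_ : _ ≤ Ideal.span (Set.range y) * maximalIdeal R) this
    · rintro _ ⟨z, hz, rfl⟩
      exact Ideal.mul_mono_left (Ideal.span_mono (Set.singleton_subset_iff.2
        (Set.mem_range_self (f := y) ⟨z, hb₁b hz⟩)))
        (hy3 ⟨z, hb₁b hz⟩ hz)
    · rw [mul_comm]; exact Ideal.mul_mono_left hIy
  · rw [pow_two]
    apply Ideal.mul_mono_left
    rw [Ideal.span_le]; rintro _ ⟨z, rfl⟩; exact (hy1 z).1

/-- Let `(R, m)` be a Noetherian local ring with `m² ≠ 0` and `ms(R) = n`.  Then there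
exist elements `y₁, …, yₙ ∈ m \ m²` such that `m² = (y₁, …, yₙ)·m`. -/
theorem stmt2 {R : Type*} [CommRing R] [IsLocalRing R] [IsNoetherianRing R]
    (hm2 : (maximalIdeal R) ^ 2 ≠ ⊥) (n : ℕ) (hn : ms R = n) :
    ∃ y : Fin n → R,
      (∀ i, y i ∈ maximalIdeal R ∧ y i ∉ (maximalIdeal R) ^ 2) ∧
      (maximalIdeal R) ^ 2 = Ideal.span (Set.range y) * maximalIdeal R := by
  have hne : {n : ℕ | ∃ I : Ideal R,
      (maximalIdeal R) ^ 2 ≤ I ∧ I ≤ maximalIdeal R ∧ mu I = n}.Nonempty :=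
    ⟨_, maximalIdeal R, Ideal.pow_le_self two_ne_zero, le_rfl, rfl⟩
  obtain ⟨I, h1, h2, hI⟩ := Nat.sInf_mem hne
  change mu I = ms R at hI
  rw [hn] at hI
  subst hI
  letI : Field (R ⧸ maximalIdeal R) := Ideal.Quotient.field _
  refine aux_core I (R ⧸ maximalIdeal R) (I ⧸ maximalIdeal R • (⊤ : Submodule R I))
    Ideal.Quotient.mk_surjective (Submodule.mkQ _) (Submodule.mkQ_surjective _) ?_ h1 h2
  intro x hx
  rw [Submodule.mkQ_apply, Submodule.Quotient.mk_eq_zero] at hx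
  have : I.subtype x ∈ (maximalIdeal R • (⊤ : Submodule R I)).map I.subtype := ⟨x, hx, rfl⟩
  rw [Submodule.map_smul'', Submodule.map_top, Submodule.range_subtype] at this
  exact this
end

section
/- Let (R, m) be a Noetherian local ring with m² ≠ 0. Then ms(R) = min{μ(I) : I an ideal of R with I ⊆ m and m·I = m²}, i.e. ms(R) equals the minimum number of generators of a reduction of m with reduction number one. -/
open IsLocalRing

theorem mu_attained {R : Type*} [CommRing R] [IsNoetherianRing R] (I : Ideal R) :
    ∃ s : Finset R, s.card = mu I ∧ Ideal.span (s : Set R) = I := by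
  have hne : {n : ℕ | ∃ s : Finset R, s.card = n ∧ Ideal.span (s : Set R) = I}.Nonempty := by
    obtain ⟨s, hs⟩ := (isNoetherianRing_iff_ideal_fg R).1 inferInstance I
    exact ⟨s.card, s, rfl, hs⟩
  exact Nat.sInf_mem hne

theorem mu_exchange {R : Type*} [CommRing R] [IsLocalRing R] [IsNoetherianRing R]
    (I : Ideal R) (a b : R) (hab : a * b ∈ I) (hn : a * b ∉ maximalIdeal R * I) :
    mu (I ⊔ Ideal.span {a}) ≤ mu I := by
  classical
  obtain ⟨s, hc, hs⟩ := mu_attained I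
  have h1 : a * b ∈ Submodule.span R (s : Set R) := by
    change a * b ∈ Ideal.span (s : Set R)
    rw [hs]; exact hab
  obtain ⟨c, -, hsum⟩ := Submodule.mem_span_finset.1 h1
  have hz : ∃ z ∈ s, c z ∉ maximalIdeal R := by
    by_contra! hcon
    apply hn
    rw [← hsum]
    refine Ideal.sum_mem _ fun z hz => ?_
    refine Ideal.mul_mem_mul (hcon z hz) ?_
    rw [← hs]
    exact Ideal.subset_span hz
  obtain ⟨z, hzs, hcz⟩ := hz
  have hu : IsUnit (c z) := by
    simpa using hcz
  have hle : (insert a (s.erase z)).card ≤ mu I := by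
    have h2 := Finset.card_insert_le a (s.erase z)
    have h3 := Finset.card_erase_add_one hzs
    omega
  refine le_trans (Nat.sInf_le ⟨insert a (s.erase z), rfl, ?_⟩) hle
  have hes : ∀ w ∈ s.erase z, w ∈ Ideal.span ((insert a (s.erase z) : Finset R) : Set R) :=
    fun w hw => Ideal.subset_span (by simp only [Finset.mem_coe]; exact Finset.mem_insert_of_mem hw)
  have ha : a ∈ Ideal.span ((insert a (s.erase z) : Finset R) : Set R) :=
    Ideal.subset_span (by simp)
  apply le_antisymm
  · rw [Ideal.span_le]
    intro w hw
    rcases Finset.mem_insert.1 (Finset.mem_coe.1 hw) with rfl | hw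
    · exact Ideal.mem_sup_right (Ideal.mem_span_singleton_self _)
    · refine Ideal.mem_sup_left ?_
      rw [← hs]
      exact Ideal.subset_span (Finset.mem_of_mem_erase hw)
  · refine sup_le ?_ ?_
    · rw [← hs, Ideal.span_le]
      intro w hw
      by_cases hwz : w = z
      · subst hwz
        rw [SetLike.mem_coe, ← Ideal.unit_mul_mem_iff_mem _ hu]
        rw [← Finset.add_sum_erase _ _ hzs] at hsum
        have h4 : c w * w = a * b - ∑ x ∈ s.erase w, c x • x := by
          rw [← hsum]; simp
        rw [h4]
        refine Ideal.sub_mem _ (Ideal.mul_mem_right _ _ ha) ?_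
        exact Ideal.sum_mem _ fun x hx => Ideal.mul_mem_left _ _ (hes x hx)
      · exact hes w (Finset.mem_erase.2 ⟨hwz, hw⟩)
    · rw [Ideal.span_singleton_le_iff_mem]
      exact ha

theorem exists_reduction {R : Type*} [CommRing R] [IsLocalRing R] [IsNoetherianRing R]
    (I : Ideal R) : (maximalIdeal R) ^ 2 ≤ I → I ≤ maximalIdeal R →
    ∃ J : Ideal R, J ≤ maximalIdeal R ∧ maximalIdeal R * J = (maximalIdeal R) ^ 2 ∧
      mu J ≤ mu I := by
  induction I using WellFoundedGT.induction with
  | ind I ih =>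
  intro h1 h2
  by_cases h : maximalIdeal R * I = (maximalIdeal R) ^ 2
  · exact ⟨I, h2, h, le_rfl⟩
  have hex : ∃ a ∈ maximalIdeal R, ∃ b ∈ maximalIdeal R, a * b ∉ maximalIdeal R * I := by
    by_contra! hcon
    apply h
    apply le_antisymm
    · rw [pow_two]; exact Ideal.mul_mono_right h2
    · rw [pow_two, Ideal.mul_le]; exact hcon
  obtain ⟨a, ha, b, hb, hab⟩ := hex
  have haI : a ∉ I := fun hh => hab (by rw [mul_comm a b]; exact Ideal.mul_mem_mul hb hh)
  have hlt : I < I ⊔ Ideal.span {a} := by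
    refine lt_of_le_of_ne le_sup_left fun he => haI ?_
    rw [he]
    exact Ideal.mem_sup_right (Ideal.mem_span_singleton_self _)
  obtain ⟨J, hJ1, hJ2, hJ3⟩ := ih _ hlt (h1.trans le_sup_left)
    (sup_le h2 ((Ideal.span_singleton_le_iff_mem _).2 ha))
  refine ⟨J, hJ1, hJ2, hJ3.trans (mu_exchange I a b (h1 ?_) hab)⟩
  rw [pow_two]; exact Ideal.mul_mem_mul ha hb

/-- Let `(R, m)` be a Noetherian local ring with `m² ≠ 0`.  Then `ms(R)` equals the
minimum of `μ(I)` over the ideals `I ⊆ m` with `m·I = m²`, i.e. `ms(R)` is the minimal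
number of generators of a reduction of `m` of reduction number one. -/
theorem stmt3 {R : Type*} [CommRing R] [IsLocalRing R] [IsNoetherianRing R]
    (hm2 : (maximalIdeal R) ^ 2 ≠ ⊥) :
    ms R = sInf {n : ℕ | ∃ I : Ideal R,
      I ≤ maximalIdeal R ∧ maximalIdeal R * I = (maximalIdeal R) ^ 2 ∧ mu I = n} := by
  unfold ms
  apply le_antisymm
  · refine le_csInf ⟨_, maximalIdeal R, le_rfl, (pow_two _).symm, rfl⟩ ?_
    rintro n ⟨I, h1, h2, rfl⟩
    exact Nat.sInf_le ⟨I, h2 ▸ Ideal.mul_le_right, h1, rfl⟩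
  · refine le_csInf ⟨_, maximalIdeal R, Ideal.pow_le_self two_ne_zero, le_rfl, rfl⟩ ?_
    rintro n ⟨I, h1, h2, rfl⟩
    obtain ⟨J, hJ1, hJ2, hJ3⟩ := exists_reduction I h1 h2
    exact le_trans (Nat.sInf_le ⟨J, hJ1, hJ2, rfl⟩) hJ3
end

section
/- Let (R, m_R) and (S, m_S) be Noetherian local rings and let φ : R → S be a surjective ring homomorphism. Then ms(R) ≥ ms(S) and cs(R) ≥ cs(S). -/
open IsLocalRing

/-- `cs R = min {μ(I) : I² = m²}`. -/
noncomputable def cs (R : Type*) [CommRing R] [IsLocalRing R] : ℕ :=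
  sInf {n : ℕ | ∃ I : Ideal R, I ^ 2 = (maximalIdeal R) ^ 2 ∧ mu I = n}

theorem mu_map_le {R S : Type*} [CommRing R] [IsNoetherianRing R] [CommRing S]
    (φ : R →+* S) (I : Ideal R) : mu (I.map φ) ≤ mu I := by
  classical
  have hne : {n : ℕ | ∃ s : Finset R, s.card = n ∧ Ideal.span (s : Set R) = I}.Nonempty := by
    obtain ⟨s, hs⟩ := (isNoetherianRing_iff_ideal_fg R).1 inferInstance I
    exact ⟨_, s, rfl, hs⟩
  obtain ⟨s, hs, hI⟩ := Nat.sInf_mem hne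
  have h1 : mu (I.map φ) ≤ (s.image φ).card := by
    refine Nat.sInf_le ⟨s.image φ, rfl, ?_⟩
    rw [← hI, Ideal.map_span, Finset.coe_image]
  have h2 : s.card = mu I := hs
  exact h1.trans (Finset.card_image_le.trans h2.le)

theorem map_max {R S : Type*} [CommRing R] [IsLocalRing R]
    [CommRing S] [IsLocalRing S] (φ : R →+* S) (hφ : Function.Surjective φ) :
    (maximalIdeal R).map φ = maximalIdeal S := by
  have : IsLocalHom φ := IsLocalHom.of_surjective φ hφ
  apply le_antisymm
  · rw [Ideal.map_le_iff_le_comap]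
    intro x hx
    simpa using hx
  · intro y hy
    obtain ⟨x, rfl⟩ := hφ y
    apply Ideal.mem_map_of_mem
    simpa using hy

/-- Let `(R, m_R)` and `(S, m_S)` be Noetherian local rings and `φ : R → S` a surjective
ring homomorphism.  Then `ms(R) ≥ ms(S)` and `cs(R) ≥ cs(S)`. -/
theorem stmt4 {R S : Type*} [CommRing R] [IsLocalRing R] [IsNoetherianRing R]
    [CommRing S] [IsLocalRing S] [IsNoetherianRing S]
    (φ : R →+* S) (hφ : Function.Surjective φ) :
    ms S ≤ ms R ∧ cs S ≤ cs R := by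
  have hm := map_max φ hφ
  constructor
  · have hne : {n : ℕ | ∃ I : Ideal R,
        (maximalIdeal R) ^ 2 ≤ I ∧ I ≤ maximalIdeal R ∧ mu I = n}.Nonempty :=
      ⟨_, maximalIdeal R, Ideal.pow_le_self two_ne_zero, le_rfl, rfl⟩
    obtain ⟨I, h1, h2, h3⟩ := Nat.sInf_mem hne
    have h3' : mu I = ms R := h3
    rw [← h3']
    refine le_trans (Nat.sInf_le ⟨I.map φ, ?_, ?_, rfl⟩) (mu_map_le φ I)
    · rw [← hm, ← Ideal.map_pow]; exact Ideal.map_mono h1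
    · rw [← hm]; exact Ideal.map_mono h2
  · have hne : {n : ℕ | ∃ I : Ideal R, I ^ 2 = (maximalIdeal R) ^ 2 ∧ mu I = n}.Nonempty :=
      ⟨_, maximalIdeal R, rfl, rfl⟩
    obtain ⟨I, h1, h3⟩ := Nat.sInf_mem hne
    have h3' : mu I = cs R := h3
    rw [← h3']
    refine le_trans (Nat.sInf_le ⟨I.map φ, ?_, rfl⟩) (mu_map_le φ I)
    rw [← hm, ← Ideal.map_pow, ← Ideal.map_pow, h1]
end

section
/- Let (R, m) be a Cohen–Macaulay Noetherian local ring of Krull dimension d > 0. Suppose x₁, …, x_d ∈ R generate an m-primary ideal I = (x₁, …, x_d), and suppose there exists an integer n ≥ 0 such that I^{n+1} = m·Iⁿ. Then R is a regular local ring. -/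
open IsLocalRing

/-- The depth of a local ring `R`: the supremum of the lengths of `R`-regular sequences
consisting of elements of the maximal ideal. -/
noncomputable def depth (R : Type*) [CommRing R] [IsLocalRing R] : ℕ∞ :=
  sSup {n : ℕ∞ | ∃ rs : List R, (rs.length : ℕ∞) = n ∧
    (∀ r ∈ rs, r ∈ maximalIdeal R) ∧ RingTheory.Sequence.IsRegular R rs}

/-- A local ring is Cohen–Macaulay if its depth equals its Krull dimension. -/
def IsCohenMacaulayLocalRing (R : Type*) [CommRing R] [IsLocalRing R] : Prop :=
  (depth R : WithBot ℕ∞) = ringKrullDim R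

/-- A local ring is regular if its maximal ideal can be generated by `dim R` elements,
i.e. `μ(m) = dim R`. -/
def IsRegularLocal (R : Type*) [CommRing R] [IsLocalRing R] : Prop :=
  (mu (maximalIdeal R) : WithBot ℕ∞) = ringKrullDim R

namespace S8

variable {R : Type*} [CommRing R]

def Reg (y : R) (J : Ideal R) : Prop := ∀ r, y * r ∈ J → r ∈ J

lemma mem_sup_single {J : Ideal R} {a s : R} :
    s ∈ J ⊔ Ideal.span {a} ↔ ∃ c, s - a * c ∈ J := by
  constructor
  · intro h
    obtain ⟨j, hj, b, hb, rfl⟩ := Submodule.mem_sup.1 h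
    obtain ⟨c, rfl⟩ := Ideal.mem_span_singleton'.1 hb
    exact ⟨c, by convert hj using 1; ring⟩
  · rintro ⟨c, hc⟩
    have : s = (s - a * c) + c * a := by ring
    rw [this]
    exact Submodule.add_mem_sup hc (Ideal.mem_span_singleton'.2 ⟨c, rfl⟩)

lemma davis (N : ℕ) : ∀ (S : Finset (Ideal R)), S.card = N → (∀ p ∈ S, p.IsPrime) →
    ∀ (z : R) (K : Ideal R), (∀ p ∈ S, ¬ (z ∈ p ∧ K ≤ p)) →
    ∃ y ∈ K, ∀ p ∈ S, z + y ∉ p := by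
  classical
  induction N with
  | zero =>
    intro S hS _ z K _
    rw [Finset.card_eq_zero] at hS
    subst hS
    exact ⟨0, K.zero_mem, by simp⟩
  | succ N ih =>
    intro S hS hp z K hK
    have hne : S.Nonempty := by
      rw [← Finset.card_pos]; omega
    obtain ⟨q, hq⟩ := S.exists_minimal hne
    have hqS := hq.1
    obtain ⟨y, hy, hyp⟩ := ih (S.erase q) (by rw [Finset.card_erase_of_mem hqS]; omega)
      (fun p h => hp p (Finset.mem_of_mem_erase h)) z K
      (fun p h => hK p (Finset.mem_of_mem_erase h))
    by_cases hzy : z + y ∈ q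
    · have hKq : ¬ K ≤ q := fun h => hK q hqS ⟨by simpa using q.sub_mem hzy (h hy), h⟩
      have hqp := hp q hqS
      have h2 : ¬ (K ⊓ (S.erase q).inf id ≤ q) := by
        intro h
        rcases hqp.inf_le.1 h with h | h
        · exact hKq h
        · obtain ⟨p, hpS, hpq⟩ := (Ideal.IsPrime.inf_le' hqp).1 h
          rw [Finset.mem_erase] at hpS
          exact hpS.1 (le_antisymm hpq (hq.2 hpS.2 hpq))
      obtain ⟨t, ht, htq⟩ := Set.not_subset.1 h2
      refine ⟨y + t, K.add_mem hy ht.1, fun p hpS hmem => ?_⟩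
      by_cases hpq : p = q
      · subst hpq
        apply htq
        have := p.sub_mem hmem hzy
        simpa [← add_assoc] using this
      · have hpe : p ∈ S.erase q := Finset.mem_erase.2 ⟨hpq, hpS⟩
        have htp : t ∈ p := (Finset.inf_le (f := id) hpe) ht.2
        apply hyp p hpe
        have := p.sub_mem hmem htp
        simpa [← add_assoc] using this
    · refine ⟨y, hy, fun p hpS => ?_⟩
      by_cases hpq : p = q
      · subst hpq; exact hzy
      · exact hyp p (Finset.mem_erase.2 ⟨hpq, hpS⟩)

lemma ass [IsNoetherianRing R] (J : Ideal R) : ∃ F : Finset (Ideal R),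
    (∀ p ∈ F, p.IsPrime ∧ ∃ s, s ∉ J ∧ ∀ t ∈ p, t * s ∈ J) ∧
    ∀ y, (∀ p ∈ F, y ∉ p) → Reg y J := by
  classical
  refine ⟨(associatedPrimes.finite R (R ⧸ J)).toFinset, ?_, ?_⟩
  · intro p hp
    rw [Set.Finite.mem_toFinset] at hp
    obtain ⟨h1, x, hx⟩ := Submodule.isAssociatedPrime_iff.1 hp
    refine ⟨h1, ?_⟩
    obtain ⟨s, rfl⟩ := Ideal.Quotient.mk_surjective x
    have key : ∀ t, t ∈ p ↔ t * s ∈ J := by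
      intro t
      rw [hx, Submodule.mem_colon_singleton, Submodule.mem_bot, ← Ideal.Quotient.eq_zero_iff_mem,
        map_mul]
      rfl
    refine ⟨s, fun hs => ?_, fun t ht => (key t).1 ht⟩
    exact h1.ne_top ((Ideal.eq_top_iff_one _).2 ((key 1).2 (by simpa using hs)))
  · intro y hy r hr
    have := biUnion_associatedPrimes_eq_compl_regular R (R ⧸ J)
    have hreg : IsSMulRegular (R ⧸ J) y := by
      by_contra hc
      have : y ∈ ⋃ p ∈ associatedPrimes R (R ⧸ J), (p : Set R) := by
        rw [this]; exact hc
      simp only [Set.mem_iUnion] at this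
      obtain ⟨p, hp, hyp⟩ := this
      exact hy p (by simpa using hp) hyp
    rw [← Ideal.Quotient.eq_zero_iff_mem] at hr ⊢
    apply hreg
    rw [map_mul] at hr
    simpa [Algebra.smul_def] using hr

variable [IsLocalRing R]

def SF (J : Ideal R) : Prop := ∀ s, (∀ t ∈ maximalIdeal R, t * s ∈ J) → s ∈ J

lemma SF_of_reg {J : Ideal R} {y : R} (hy : y ∈ maximalIdeal R) (h : Reg y J) : SF J :=
  fun s hs => h s (hs y hy)

lemma exists_reg [IsNoetherianRing R] (T : Finset (Ideal R)) (hT : ∀ J ∈ T, SF J) (z : R)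
    (K : Ideal R) (hm : maximalIdeal R ≤ (K ⊔ Ideal.span {z}).radical) :
    ∃ y ∈ K, ∀ J ∈ T, Reg (z + y) J := by
  classical
  choose F hF1 hF2 using ass (R := R)
  obtain ⟨y, hy, h⟩ := davis _ (T.biUnion F) rfl
    (fun p hp => by
      obtain ⟨J, _, h⟩ := Finset.mem_biUnion.1 hp
      exact (hF1 J p h).1) z K (fun p hp ⟨hz, hK⟩ => by
      obtain ⟨J, hJ, h⟩ := Finset.mem_biUnion.1 hp
      obtain ⟨hpr, s, hs, hps⟩ := hF1 J p h
      refine hs (hT J hJ s fun t ht => hps t ?_)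
      have h1 : K ⊔ Ideal.span {z} ≤ p := sup_le hK (by
        rw [Ideal.span_singleton_le_iff_mem]; exact hz)
      exact hpr.radical_le_iff.2 h1 (hm ht))
  exact ⟨y, hy, fun J hJ => hF2 J _ fun p hp => h p (Finset.mem_biUnion.2 ⟨J, hJ, hp⟩)⟩

lemma SF_exch {J : Ideal R} {a b : R} (ha : Reg a J) (hb : Reg b J)
    (h : SF (J ⊔ Ideal.span {a})) (hb' : a ∈ maximalIdeal R) : SF (J ⊔ Ideal.span {b}) := by
  intro s hs
  obtain ⟨n, hn⟩ := mem_sup_single.1 (hs a hb')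
  have h1 : n ∈ J ⊔ Ideal.span {a} := by
    apply h
    intro t ht
    obtain ⟨c, hc⟩ := mem_sup_single.1 (hs t ht)
    refine mem_sup_single.2 ⟨c, hb _ ?_⟩
    have := J.sub_mem (J.mul_mem_left a hc) (J.mul_mem_left t hn)
    convert this using 1; ring
  obtain ⟨e, he⟩ := mem_sup_single.1 h1
  refine mem_sup_single.2 ⟨e, ha _ ?_⟩
  have := J.add_mem hn (J.mul_mem_left b he)
  convert this using 1; ring

lemma perm {J : Ideal R} {a z : R} (ha : Reg a J) (hz : Reg z (J ⊔ Ideal.span {a})) :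
    Reg a (J ⊔ Ideal.span {z}) := by
  intro r hr
  obtain ⟨c, hc⟩ := mem_sup_single.1 hr
  have h1 : c ∈ J ⊔ Ideal.span {a} := by
    apply hz
    refine mem_sup_single.2 ⟨r, ?_⟩
    have := J.neg_mem hc
    convert this using 1; ring
  obtain ⟨e, he⟩ := mem_sup_single.1 h1
  refine mem_sup_single.2 ⟨e, ha _ ?_⟩
  have := J.add_mem hc (J.mul_mem_left z he)
  convert this using 1; ring

def D : ℕ → Ideal R → Prop
  | 0, _ => True
  | k + 1, J => ∃ y ∈ maximalIdeal R, Reg y J ∧ D k (J ⊔ Ideal.span {y})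

lemma D_succ {k : ℕ} {J : Ideal R} : D (k + 1) J ↔
    ∃ y ∈ maximalIdeal R, Reg y J ∧ D k (J ⊔ Ideal.span {y}) := Iff.rfl

lemma D_exch [IsNoetherianRing R] (k : ℕ) : ∀ (J : Ideal R) (x : R), x ∈ maximalIdeal R →
    Reg x J → D (k + 1) J → D k (J ⊔ Ideal.span {x}) := by
  classical
  induction k with
  | zero => intros; trivial
  | succ k ih =>
    intro J x hx hxJ hD
    obtain ⟨y, hy, hyJ, hD1⟩ := D_succ.1 hD
    obtain ⟨w, hw, hwJ, -⟩ := D_succ.1 hD1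
    have s1 : SF (J ⊔ Ideal.span {y}) := SF_of_reg hw hwJ
    have s2 : SF (J ⊔ Ideal.span {x}) := SF_exch hyJ hxJ s1 hy
    obtain ⟨z, hz, hzT⟩ := exists_reg {J, J ⊔ Ideal.span {y}, J ⊔ Ideal.span {x}}
      (by
        intro I hI
        simp only [Finset.mem_insert, Finset.mem_singleton] at hI
        rcases hI with rfl | rfl | rfl
        · exact SF_of_reg hy hyJ
        · exact s1
        · exact s2) 0 (maximalIdeal R) (le_trans le_sup_left Ideal.le_radical)
    rw [zero_add] at hzT
    have z1 := hzT J (by simp)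
    have z2 := hzT (J ⊔ Ideal.span {y}) (by simp)
    have z3 := hzT (J ⊔ Ideal.span {x}) (by simp)
    have e1 := ih _ z hz z2 hD1
    rw [sup_right_comm] at e1
    have e2 : D (k + 1) (J ⊔ Ideal.span {z}) := D_succ.2 ⟨y, hy, perm hyJ z2, e1⟩
    have e3 := ih _ x hx (perm hxJ z3) e2
    rw [sup_right_comm] at e3
    exact D_succ.2 ⟨z, hz, z3, e3⟩

lemma main [IsNoetherianRing R] (d : ℕ) : ∀ (J : Ideal R) (xs : List R), xs.length = d + 1 →
    D (d + 1) J → ∀ I : Ideal R, I = J ⊔ Ideal.ofList xs → I.radical = maximalIdeal R →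
    ∀ (a : R) (n : ℕ), (∀ t ∈ I ^ n, a * t ∈ I ^ (n + 1) ⊔ J) → a ∈ I := by
  classical
  induction d with
  | zero =>
    intro J xs hl hD I hI hrad a n ha
    obtain ⟨x, rfl⟩ := List.length_eq_one_iff.1 hl
    rw [Ideal.ofList_singleton] at hI
    obtain ⟨w, hw, hwJ, -⟩ := D_succ.1 hD
    obtain ⟨y, hy, hyT⟩ := exists_reg {J} (by simpa using SF_of_reg hw hwJ) x J
      (by rw [← hI, hrad])
    have hz := hyT J (by simp)
    have hx : Reg x J := by
      intro r hr
      apply hz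
      rw [add_mul]
      exact J.add_mem hr (J.mul_mem_right _ hy)
    have hpow : ∀ (k : ℕ) r, x ^ k * r ∈ J → r ∈ J := by
      intro k
      induction k with
      | zero => intro r hr; simpa using hr
      | succ k ihk =>
        intro r hr
        apply ihk; apply hx
        convert hr using 1; ring
    have hIp : I ^ (n + 1) ⊔ J ≤ J ⊔ Ideal.span {x ^ (n + 1)} := by
      refine sup_le ?_ le_sup_left
      rw [hI, ← Ideal.span_singleton_pow]
      intro t ht
      clear ha
      generalize n + 1 = k at ht ⊢
      induction k generalizing t with
      | zero => simp
      | succ k ihk =>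
        rw [pow_succ] at ht
        refine Submodule.mul_induction_on ht ?_ (fun _ _ => Ideal.add_mem _)
        intro u hu v hv
        rw [Ideal.span_singleton_pow] at ihk ⊢
        obtain ⟨c, hc⟩ := mem_sup_single.1 (ihk hu)
        obtain ⟨e, he⟩ := mem_sup_single.1 hv
        refine mem_sup_single.2 ⟨c * e, ?_⟩
        have := J.add_mem (J.mul_mem_right v hc) (J.mul_mem_left (x ^ k * c) he)
        convert this using 1; ring
    have hxI : x ∈ I := by
      rw [hI]; exact Ideal.mem_sup_right (Ideal.mem_span_singleton_self x)
    obtain ⟨c, hc⟩ := mem_sup_single.1 (hIp (ha (x ^ n) (Ideal.pow_mem_pow hxI n)))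
    rw [hI]
    refine mem_sup_single.2 ⟨c, hpow n _ ?_⟩
    convert hc using 1; ring
  | succ d ih =>
    intro J xs hl hD I hI hrad a n ha
    obtain ⟨x, xs, rfl⟩ : ∃ x ys, xs = x :: ys := List.exists_cons_of_length_eq_add_one hl
    rw [Ideal.ofList_cons] at hI
    obtain ⟨w, hw, hwJ, -⟩ := D_succ.1 hD
    have hI' : I = (J ⊔ Ideal.ofList xs) ⊔ Ideal.span {x} := by
      rw [hI, sup_assoc, sup_comm (Ideal.span {x})]
    obtain ⟨y, hy, hyT⟩ := exists_reg {J} (by simpa using SF_of_reg hw hwJ) x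
      (J ⊔ Ideal.ofList xs) (by rw [← hI', hrad])
    have hz := hyT J (by simp)
    have hxI : x ∈ I := by
      rw [hI']; exact Ideal.mem_sup_right (Ideal.mem_span_singleton_self x)
    have hyI : y ∈ I := by
      rw [hI']; exact Ideal.mem_sup_left hy
    have hzI := I.add_mem hxI hyI
    have hzm : x + y ∈ maximalIdeal R := hrad ▸ Ideal.le_radical hzI
    refine ih (J ⊔ Ideal.span {x + y}) xs (by simpa using hl) (D_exch _ _ _ hzm hz hD) I ?_ hrad
      a n (fun t ht => ?_)
    · rw [sup_right_comm]
      apply le_antisymm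
      · rw [hI']
        refine sup_le le_sup_left ?_
        rw [Ideal.span_singleton_le_iff_mem]
        have h1 : x + y ∈ J ⊔ Ideal.ofList xs ⊔ Ideal.span {x + y} :=
          Ideal.mem_sup_right (Ideal.mem_span_singleton_self _)
        simpa using Ideal.sub_mem _ h1 (Ideal.mem_sup_left hy)
      · refine sup_le (hI' ▸ le_sup_left) ?_
        rwa [Ideal.span_singleton_le_iff_mem]
    · exact (sup_le_sup_left (le_sup_left : J ≤ J ⊔ Ideal.span {x + y}) _) (ha t ht)

lemma D_mono (k : ℕ) : ∀ (l : ℕ) (J : Ideal R), k ≤ l → D l J → D k J := by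
  induction k with
  | zero => intros; trivial
  | succ k ih =>
    intro l J hkl h
    obtain ⟨l, rfl⟩ : ∃ l', l = l' + 1 := ⟨l - 1, by omega⟩
    obtain ⟨y, hy, h1, h2⟩ := D_succ.1 h
    exact D_succ.2 ⟨y, hy, h1, ih l _ (by omega) h2⟩

lemma D_of_list (rs : List R) (hm : ∀ r ∈ rs, r ∈ maximalIdeal R)
    (h : RingTheory.Sequence.IsWeaklyRegular R rs) :
    ∀ k i, i + k = rs.length → D k (Ideal.ofList (rs.take i)) := by
  intro k
  induction k with
  | zero => intros; trivial
  | succ k ih =>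
    intro i hi
    have hlt : i < rs.length := by omega
    refine D_succ.2 ⟨rs[i], hm _ (List.getElem_mem hlt), ?_, ?_⟩
    · intro r hr
      have h1 := h.regular_mod_prev i hlt
      have e : (Ideal.ofList (rs.take i) • ⊤ : Submodule R R) = Ideal.ofList (rs.take i) := by
        simp
      rw [e] at h1
      have hr' : Ideal.Quotient.mk _ (rs[i] * r) = 0 := Ideal.Quotient.eq_zero_iff_mem.2 hr
      rw [← Ideal.Quotient.eq_zero_iff_mem]
      apply h1
      rw [map_mul] at hr'
      simpa [Algebra.smul_def] using hr'
    · have := ih (i + 1) (by omega)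
      rwa [List.take_add_one, List.getElem?_eq_getElem hlt, Option.toList_some,
        Ideal.ofList_append, Ideal.ofList_singleton] at this

lemma D_of_depth {d : ℕ} (hd : 0 < d) (h : depth R = d) : D d (⊥ : Ideal R) := by
  obtain ⟨e, rfl⟩ : ∃ e, d = e + 1 := ⟨d - 1, by omega⟩
  have hlt : (e : ℕ∞) < depth R := by rw [h]; exact_mod_cast Nat.lt_succ_self e
  obtain ⟨n, ⟨rs, hl, hm, hr⟩, hn⟩ := lt_sSup_iff.1 hlt
  have := D_of_list rs hm hr.toIsWeaklyRegular rs.length 0 (by simp)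
  rw [← hl] at hn
  have hn' : e < rs.length := by exact_mod_cast hn
  exact D_mono _ _ _ hn' (by simpa using this)

end S8

/-- Let `(R, m)` be a Cohen–Macaulay Noetherian local ring of Krull dimension `d > 0`.
If `x₁, …, x_d ∈ R` generate an `m`-primary ideal `I = (x₁, …, x_d)` and there is an
integer `n ≥ 0` with `I^{n+1} = m·Iⁿ`, then `R` is regular. -/
theorem stmt8 {R : Type*} [CommRing R] [IsLocalRing R] [IsNoetherianRing R]
    (hCM : IsCohenMacaulayLocalRing R)
    (d : ℕ) (hd : 0 < d) (hdim : ringKrullDim R = (d : WithBot ℕ∞))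
    (x : Fin d → R)
    (hprimary : (Ideal.span (Set.range x)).radical = maximalIdeal R)
    (n : ℕ)
    (hred : Ideal.span (Set.range x) ^ (n + 1) =
      maximalIdeal R * Ideal.span (Set.range x) ^ n) :
    IsRegularLocal R := by
  have hdep : depth R = d := by
    unfold IsCohenMacaulayLocalRing at hCM
    rw [hdim] at hCM
    exact_mod_cast hCM
  have hD := S8.D_of_depth hd hdep
  have hI : maximalIdeal R = Ideal.span (Set.range x) := by
    apply le_antisymm
    · intro a ha
      obtain ⟨e, rfl⟩ : ∃ e, d = e + 1 := ⟨d - 1, by omega⟩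
      refine S8.main e ⊥ (List.ofFn x) (by simp) hD _ ?_ hprimary a n (fun t ht => ?_)
      · rw [bot_sup_eq, Ideal.ofList]
        congr 1
        ext r
        exact (List.mem_ofFn' x r).symm
      · rw [hred]
        exact Ideal.mem_sup_left (Ideal.mul_mem_mul ha ht)
    · rw [← hprimary]; exact Ideal.le_radical
  unfold IsRegularLocal
  have hset : ∃ s : Finset R, s.card ≤ d ∧ Ideal.span (s : Set R) = maximalIdeal R := by
    classical
    refine ⟨Finset.univ.image x, ?_, ?_⟩
    · exact Finset.card_image_le.trans (by simp)
    · simp [hI]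
  obtain ⟨s, hs, hsp⟩ := hset
  have h1 : mu (maximalIdeal R) ≤ d := by
    refine le_trans ?_ hs
    exact Nat.sInf_le ⟨s, rfl, hsp⟩
  have h2 : d ≤ mu (maximalIdeal R) := by
    obtain ⟨t, ht, htp⟩ := Nat.sInf_mem (s := {n : ℕ | ∃ s : Finset R, s.card = n ∧
      Ideal.span (s : Set R) = maximalIdeal R}) ⟨_, s, rfl, hsp⟩
    have h3 := ringKrullDim_le_spanFinrank_maximalIdeal (R := R)
    rw [hdim] at h3
    have h3' : d ≤ (maximalIdeal R).spanFinrank := by exact_mod_cast h3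
    have h4 := Submodule.spanFinrank_span_le_ncard_of_finite (R := R) t.finite_toSet
    rw [Set.ncard_coe_finset, ht] at h4
    change (Ideal.span (t : Set R)).spanFinrank ≤ _ at h4
    rw [htp] at h4
    exact h3'.trans h4
  rw [hdim, le_antisymm h1 h2]
end

section
/- Let (R, m) be a Cohen–Macaulay Noetherian local ring with dim R > 0. Then cs(R) = dim R if and only if R is a regular local ring. -/
open IsLocalRing

open RingTheory.Sequence Pointwise

section helpers

universe u

variable {R : Type u} [CommRing R] [IsLocalRing R] [IsNoetherianRing R]

lemma aux_exists_regular (N : Type u) [AddCommGroup N] [Module R N] [Module.Finite R N]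
    (h : ∀ z : N, (∀ r ∈ maximalIdeal R, r • z = 0) → z = 0) :
    ∃ c ∈ maximalIdeal R, IsSMulRegular N c := by
  by_contra! hc
  have hsub : ((maximalIdeal R : Ideal R) : Set R) ⊆ ⋃ p ∈ associatedPrimes R N, ((id p : Ideal R) : Set R) := by
    have := biUnion_associatedPrimes_eq_compl_regular R N
    simp only [id]
    rw [this]
    exact fun x hx => hc x hx
  obtain ⟨p, hp, hle⟩ := ((maximalIdeal R).subset_union_prime_finite
    (associatedPrimes.finite R N) (f := id) 0 0 fun _ h _ _ => h.1).1 hsub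
  rw [AssociatedPrimes.mem_iff, isAssociatedPrime_iff] at hp
  obtain ⟨hprime, x, rfl⟩ := hp
  have hx : x = 0 := h x fun r hr => by
    have := hle hr
    simpa [Submodule.mem_colon_singleton] using this
  apply hprime.ne_top
  rw [hx, Ideal.eq_top_iff_one]
  simp [Submodule.mem_colon_singleton]

lemma aux_exchange (n : ℕ) : ∀ (M : Type u) [AddCommGroup M] [Module R M] [Module.Finite R M]
    (a : R), a ∈ maximalIdeal R → IsSMulRegular M a → ∀ rs : List R, rs.length = n + 1 →
    (∀ r ∈ rs, r ∈ maximalIdeal R) → IsWeaklyRegular M rs →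
    ∃ ss : List R, ss.length = n ∧ (∀ r ∈ ss, r ∈ maximalIdeal R) ∧
      IsWeaklyRegular M (a :: ss) := by
  induction n with
  | zero =>
    intro M _ _ _ a ha hreg rs _ _ _
    exact ⟨[], rfl, by simp, by simpa using hreg⟩
  | succ n ih =>
    intro M _ _ _ a ha hreg rs hlen hmem hrs
    match rs, hlen with
    | b :: c₀ :: rs', hlen =>
    have hb : b ∈ maximalIdeal R := hmem b (by simp)
    have hc₀ : c₀ ∈ maximalIdeal R := hmem c₀ (by simp)
    have hrs2 := hrs
    rw [isWeaklyRegular_cons_iff] at hrs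
    obtain ⟨hbreg, hrs⟩ := hrs
    have hc₀reg := ((isWeaklyRegular_cons_iff _ _ _).1 hrs).1
    obtain ⟨c, hc, hcreg⟩ := aux_exists_regular (R := R) (QuotSMulTop a M × QuotSMulTop b M) (by
      rintro ⟨z, w⟩ hzw
      have hw0 : w = 0 := by
        have := congrArg Prod.snd (hzw c₀ hc₀)
        exact hc₀reg (by simpa using this)
      have hz0 : z = 0 := by
        obtain ⟨z, rfl⟩ := Submodule.Quotient.mk_surjective _ z
        have hz : ∀ r ∈ maximalIdeal R, ∃ y : M, a • y = r • z := by
          intro r hr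
          have := congrArg Prod.fst (hzw r hr)
          simp only [Prod.smul_fst, Prod.fst_zero] at this
          rw [← Submodule.Quotient.mk_smul, Submodule.Quotient.mk_eq_zero,
            Submodule.mem_smul_pointwise_iff_exists] at this
          obtain ⟨y, _, hy⟩ := this
          exact ⟨y, hy⟩
        obtain ⟨v, hv⟩ := hz b hb
        have hv0 : (Submodule.Quotient.mk v : QuotSMulTop b M) = 0 := by
          apply hc₀reg
          simp only [smul_zero]
          rw [← Submodule.Quotient.mk_smul, Submodule.Quotient.mk_eq_zero,
            Submodule.mem_smul_pointwise_iff_exists]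
          obtain ⟨y, hy⟩ := hz c₀ hc₀
          refine ⟨y, trivial, hreg ?_⟩
          show a • b • y = a • c₀ • v
          rw [smul_comm a b, hy, smul_comm a c₀, hv, smul_comm]
        rw [Submodule.Quotient.mk_eq_zero, Submodule.mem_smul_pointwise_iff_exists] at hv0
        obtain ⟨y, _, hy⟩ := hv0
        rw [Submodule.Quotient.mk_eq_zero, Submodule.mem_smul_pointwise_iff_exists]
        refine ⟨y, trivial, hbreg ?_⟩
        show b • a • y = b • z
        rw [← hv, ← hy, smul_comm]
      simp [hw0, hz0])
    have hca : IsSMulRegular (QuotSMulTop a M) c := fun x y hxy => by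
      have := @hcreg (x, 0) (y, 0) (by simpa using hxy)
      simpa using this
    have hcb : IsSMulRegular (QuotSMulTop b M) c := fun x y hxy => by
      have := @hcreg (0, x) (0, y) (by simpa using hxy)
      simpa using this
    have hac : IsWeaklyRegular M [c, a] :=
      IsLocalRing.isWeaklyRegular_of_perm_of_subset_maximalIdeal (rs := [a, c])
        (by simp [hreg, hca]) (List.Perm.swap _ _ _) (List.forall_mem_cons.2 ⟨ha, List.forall_mem_cons.2 ⟨hc, by simp⟩⟩)
    obtain ⟨hcM, hac⟩ := (isWeaklyRegular_cons_iff _ _ _).1 hac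
    have hac := ((isWeaklyRegular_cons_iff _ _ _).1 hac).1
    obtain ⟨ss, hsl, hsm, hss⟩ := ih (QuotSMulTop b M) c hc hcb (c₀ :: rs') (by simpa using hlen)
      (fun r hr => hmem r (List.mem_cons_of_mem _ hr)) hrs
    have h1 : IsWeaklyRegular M (c :: b :: ss) :=
      IsLocalRing.isWeaklyRegular_of_perm_of_subset_maximalIdeal (rs := b :: c :: ss)
        ((isWeaklyRegular_cons_iff _ _ _).2 ⟨hbreg, hss⟩) (List.Perm.swap _ _ _)
        (List.forall_mem_cons.2 ⟨hb, List.forall_mem_cons.2 ⟨hc, hsm⟩⟩)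
    obtain ⟨_, h1⟩ := (isWeaklyRegular_cons_iff _ _ _).1 h1
    obtain ⟨ts, htl, htm, hts⟩ := ih (QuotSMulTop c M) a ha hac (b :: ss) (by simpa using hsl)
      (List.forall_mem_cons.2 ⟨hb, hsm⟩) h1
    refine ⟨c :: ts, by simpa using htl, List.forall_mem_cons.2 ⟨hc, htm⟩, ?_⟩
    exact IsLocalRing.isWeaklyRegular_of_perm_of_subset_maximalIdeal (rs := c :: a :: ts)
        ((isWeaklyRegular_cons_iff _ _ _).2 ⟨hcM, hts⟩) (List.Perm.swap _ _ _)
        (List.forall_mem_cons.2 ⟨hc, List.forall_mem_cons.2 ⟨ha, htm⟩⟩)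

lemma aux_ass (rs : List R) : ∀ (M : Type u) [AddCommGroup M] [Module R M] [Module.Finite R M]
    (p : Ideal R), IsAssociatedPrime p M → (∀ r ∈ rs, r ∈ maximalIdeal R) →
    IsWeaklyRegular M rs → ((rs.length : ℕ) : WithBot ℕ∞) ≤ ringKrullDim (R ⧸ p) := by
  induction rs with
  | nil =>
    intro M _ _ _ p hp _ _
    have := hp.isPrime
    simpa using ringKrullDim_nonneg_of_nontrivial (R := R ⧸ p)
  | cons b rs ih =>
    intro M _ _ _ p hp hmem hrs
    have hpp := hp.isPrime
    have hb : b ∈ maximalIdeal R := hmem b (by simp)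
    obtain ⟨hbreg, hrs⟩ := (isWeaklyRegular_cons_iff _ _ _).1 hrs
    obtain ⟨_, x, hx⟩ := isAssociatedPrime_iff.1 hp
    have hx0 : x ≠ 0 := by
      rintro rfl
      apply hpp.ne_top
      rw [hx, Ideal.eq_top_iff_one]
      simp [Submodule.mem_colon_singleton]
    have hbp : b ∉ p := by
      intro hbp
      rw [hx, Submodule.mem_colon_singleton, Submodule.mem_bot] at hbp
      exact hx0 (hbreg (by simpa using hbp))
    let N : Submodule R M :=
      { carrier := {y | ∀ r ∈ p, r • y = 0}
        add_mem' := fun {y z} hy hz r hr => by rw [smul_add, hy r hr, hz r hr, add_zero]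
        zero_mem' := fun r _ => smul_zero r
        smul_mem' := fun c y hy r hr => by rw [smul_comm, hy r hr, smul_zero] }
    have hxN : x ∈ N := fun r hr => by
      rw [hx, Submodule.mem_colon_singleton, Submodule.mem_bot] at hr
      exact hr
    have hex : ∃ z ∈ N, z ∉ b • (⊤ : Submodule R M) := by
      by_contra! hcon
      have hN : N ≤ maximalIdeal R • N := by
        intro z hz
        obtain ⟨y, _, rfl⟩ := (Submodule.mem_smul_pointwise_iff_exists _ _ _).1 (hcon z hz)
        refine Submodule.smul_mem_smul hb fun r hr => hbreg ?_
        show b • r • y = b • (0 : M)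
        rw [smul_comm, hz r hr, smul_zero]
      have : N = ⊥ := Submodule.eq_bot_of_le_smul_of_le_jacobson_bot _ _
        (IsNoetherian.noetherian N) hN (IsLocalRing.maximalIdeal_le_jacobson _)
      rw [this] at hxN
      exact hx0 (by simpa using hxN)
    obtain ⟨z, hzN, hz⟩ := hex
    obtain ⟨q, hq, hle⟩ := exists_le_isAssociatedPrime_of_isNoetherianRing R
      (Submodule.Quotient.mk z : QuotSMulTop b M) (by rwa [Ne, Submodule.Quotient.mk_eq_zero])
    have hpq : p ≤ q := fun r hr => hle (by
      rw [Submodule.mem_colon_singleton, ← Submodule.Quotient.mk_smul, hzN r hr]; simp)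
    have hbq : b ∈ q := hle (by
      rw [Submodule.mem_colon_singleton, ← Submodule.Quotient.mk_smul, Submodule.mem_bot,
        Submodule.Quotient.mk_eq_zero]
      exact Submodule.smul_mem_pointwise_smul _ _ _ trivial)
    have h1 := ih (QuotSMulTop b M) q hq (fun r hr => hmem r (List.mem_cons_of_mem _ hr)) hrs
    have h2 : ringKrullDim (R ⧸ q) + 1 ≤ ringKrullDim (R ⧸ p) :=
      ringKrullDim_succ_le_of_surjective (Ideal.Quotient.factor hpq)
        (Ideal.Quotient.factor_surjective hpq) (r := Ideal.Quotient.mk p b)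
        (mem_nonZeroDivisors_of_ne_zero (by rwa [Ne, Ideal.Quotient.eq_zero_iff_mem]))
        (by simpa [Ideal.Quotient.eq_zero_iff_mem] using hbq)
    refine le_trans ?_ h2
    rw [List.length_cons]
    push_cast
    gcongr

lemma aux_dim (p : Ideal R) [p.IsPrime] (as : List R)
    (hmem : ∀ r ∈ as, r ∈ maximalIdeal R)
    (h : ∀ q : Ideal R, q.IsPrime → p ≤ q → (∀ r ∈ as, r ∈ q) → maximalIdeal R ≤ q) :
    ringKrullDim (R ⧸ p) ≤ ((as.length : ℕ) : WithBot ℕ∞) := by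
  classical
  have : IsLocalRing (R ⧸ p) :=
    IsLocalRing.of_surjective' (Ideal.Quotient.mk p) Ideal.Quotient.mk_surjective
  rw [← IsLocalRing.maximalIdeal_height_eq_ringKrullDim]
  let s : Finset (R ⧸ p) := (as.map (Ideal.Quotient.mk p)).toFinset
  have hs : s.card ≤ as.length := by
    simpa using List.toFinset_card_le (as.map (Ideal.Quotient.mk p))
  have hle : ∀ q : Ideal (R ⧸ p), q.IsPrime → Ideal.span (s : Set (R ⧸ p)) ≤ q →
      maximalIdeal (R ⧸ p) ≤ q := by
    intro q hq hsq
    have h1 := h (q.comap (Ideal.Quotient.mk p)) inferInstance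
      (fun r hr => by simp [Ideal.mem_comap, Ideal.Quotient.eq_zero_iff_mem.2 hr])
      (fun r hr => hsq (Ideal.subset_span (by
        simp only [s, List.coe_toFinset, Set.mem_ofPred_eq]
        exact List.mem_map_of_mem hr)))
    intro x hx
    obtain ⟨x, rfl⟩ := Ideal.Quotient.mk_surjective x
    refine h1 (?_ : x ∈ maximalIdeal R)
    rw [IsLocalRing.mem_maximalIdeal, mem_nonunits_iff] at hx ⊢
    exact fun hu => hx (hu.map _)
  have hmin : maximalIdeal (R ⧸ p) ∈ (Ideal.span (s : Set (R ⧸ p))).minimalPrimes := by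
    refine ⟨⟨inferInstance, ?_⟩, fun q hq _ => hle q hq.1 hq.2⟩
    rw [Ideal.span_le]
    intro y hy
    simp only [s, List.coe_toFinset, Set.mem_ofPred_eq, List.mem_map] at hy
    obtain ⟨r, hr, rfl⟩ := hy
    have hr := hmem r hr
    have : p.map (Ideal.Quotient.mk p) = ⊥ := Ideal.map_quotient_self p
    rw [SetLike.mem_coe, IsLocalRing.mem_maximalIdeal, mem_nonunits_iff]
    have hl : IsLocalHom (Ideal.Quotient.mk p) :=
      IsLocalHom.of_surjective _ Ideal.Quotient.mk_surjective
    exact fun hu => hr (isUnit_of_map_unit _ _ hu)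
  have h3 := Ideal.height_le_card_of_mem_minimalPrimes_span_finset hmin
  have h4 : (maximalIdeal (R ⧸ p)).height ≤ ((as.length : ℕ) : ℕ∞) :=
    h3.trans (by exact_mod_cast hs)
  exact_mod_cast h4

lemma aux_sop (as : List R) : ∀ (M : Type u) [AddCommGroup M] [Module R M] [Module.Finite R M],
    (∀ r ∈ as, r ∈ maximalIdeal R) →
    (∀ q : Ideal R, q.IsPrime → Module.annihilator R M ≤ q → (∀ r ∈ as, r ∈ q) →
      maximalIdeal R ≤ q) →
    (∃ rs : List R, rs.length = as.length ∧ (∀ r ∈ rs, r ∈ maximalIdeal R) ∧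
      IsWeaklyRegular M rs) → IsWeaklyRegular M as := by
  induction as with
  | nil => intros; simp
  | cons a as ih =>
    rintro M _ _ _ hmem hq ⟨rs, hl, hrm, hrs⟩
    have ha : a ∈ maximalIdeal R := hmem a (by simp)
    have hreg : IsSMulRegular M a := by
      by_contra hna
      have : a ∈ ⋃ p ∈ associatedPrimes R M, (p : Set R) := by
        rw [biUnion_associatedPrimes_eq_compl_regular R M]; exact hna
      simp only [Set.mem_iUnion] at this
      obtain ⟨p, hp, hap⟩ := this
      have hpp : p.IsPrime := IsAssociatedPrime.isPrime hp
      have h1 := aux_ass rs M p hp hrm hrs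
      have h2 := aux_dim p as (fun r hr => hmem r (List.mem_cons_of_mem _ hr)) (by
        intro q hqp hpq hr
        refine hq q hqp (le_trans (by simpa [Submodule.annihilator_top] using IsAssociatedPrime.annihilator_le hp) hpq) ?_
        intro r hr'
        rcases List.mem_cons.1 hr' with rfl | h
        · exact hpq hap
        · exact hr r h)
      have h3 := h1.trans h2
      rw [hl] at h3
      have h4 : (a :: as).length ≤ as.length := by exact_mod_cast h3
      simp at h4
    obtain ⟨ss, hsl, hsm, hss⟩ := aux_exchange as.length M a ha hreg rs (by simpa using hl) hrm hrs
    refine (isWeaklyRegular_cons_iff _ _ _).2 ⟨hreg, ih _ (fun r hr => hmem r (by simp [hr])) ?_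
      ⟨ss, hsl, hsm, ((isWeaklyRegular_cons_iff _ _ _).1 hss).2⟩⟩
    intro q hqp hann hr
    refine hq q hqp (le_trans ?_ hann) ?_
    · exact (LinearMap.annihilator_le_of_surjective _
        (Submodule.mkQ_surjective (a • (⊤ : Submodule R M))))
    · intro r hr'
      rcases List.mem_cons.1 hr' with rfl | h
      · apply hann
        rw [Module.mem_annihilator]
        intro y
        obtain ⟨y, rfl⟩ := Submodule.Quotient.mk_surjective _ y
        rw [← Submodule.Quotient.mk_smul, Submodule.Quotient.mk_eq_zero]
        exact Submodule.smul_mem_pointwise_smul _ _ _ trivial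
      · exact hr r h

lemma aux_mu (I : Ideal R) : ∃ s : Finset R, s.card = mu I ∧ Ideal.span (s : Set R) = I := by
  have : {n : ℕ | ∃ s : Finset R, s.card = n ∧ Ideal.span (s : Set R) = I}.Nonempty := by
    obtain ⟨s, hs⟩ := IsNoetherian.noetherian I
    exact ⟨_, s, rfl, hs⟩
  exact Nat.sInf_mem this

lemma aux_cs : ∃ I : Ideal R, I ^ 2 = (maximalIdeal R) ^ 2 ∧ mu I = cs R := by
  have : {n : ℕ | ∃ I : Ideal R, I ^ 2 = (maximalIdeal R) ^ 2 ∧ mu I = n}.Nonempty :=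
    ⟨_, maximalIdeal R, rfl, rfl⟩
  exact Nat.sInf_mem this

lemma aux_le (I : Ideal R) (hI : I ^ 2 = (maximalIdeal R) ^ 2) : I ≤ maximalIdeal R := by
  apply IsLocalRing.le_maximalIdeal
  rintro rfl
  rw [← Ideal.one_eq_top, one_pow] at hI
  have : (maximalIdeal R) ^ 2 ≤ maximalIdeal R := Ideal.pow_le_self two_ne_zero
  rw [← hI, Ideal.one_eq_top] at this
  exact (IsLocalRing.maximalIdeal.isMaximal R).ne_top (top_le_iff.1 this)

lemma aux_prime (I : Ideal R) (hI : I ^ 2 = (maximalIdeal R) ^ 2) (q : Ideal R) (hq : q.IsPrime)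
    (h : I ≤ q) : maximalIdeal R ≤ q := by
  apply hq.le_of_pow_le (n := 2)
  rw [← hI]
  exact (Ideal.pow_le_self two_ne_zero).trans h

lemma aux_dim_le_cs : ringKrullDim R ≤ (cs R : WithBot ℕ∞) := by
  obtain ⟨I, hI, hmu⟩ := aux_cs (R := R)
  obtain ⟨s, hs, hsI⟩ := aux_mu I
  rw [← IsLocalRing.maximalIdeal_height_eq_ringKrullDim]
  have hmin : maximalIdeal R ∈ (Ideal.span (s : Set R)).minimalPrimes := by
    rw [hsI]
    exact ⟨⟨inferInstance, aux_le I hI⟩, fun q hq _ => aux_prime I hI q hq.1 hq.2⟩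
  have h3 := Ideal.height_le_card_of_mem_minimalPrimes_span_finset hmin
  rw [hs, hmu] at h3
  exact_mod_cast h3

lemma aux_eq (I : Ideal R) (hI : I ^ 2 = (maximalIdeal R) ^ 2) (as : List R)
    (has : Ideal.ofList as = I) (hne : as ≠ []) (hreg : IsWeaklyRegular R as) :
    I = maximalIdeal R := by
  refine le_antisymm (aux_le I hI) fun x hx => ?_
  obtain ⟨bs, a, rfl⟩ : ∃ bs a, as = bs ++ [a] :=
    ⟨as.dropLast, as.getLast hne, (List.dropLast_append_getLast hne).symm⟩
  rw [isWeaklyRegular_append_iff, isWeaklyRegular_singleton_iff] at hreg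
  have hreg := hreg.2
  rw [Ideal.ofList_append, Ideal.ofList_singleton] at has
  have haI : a ∈ I := by
    rw [← has]; exact Ideal.mem_sup_right (Ideal.mem_span_singleton_self a)
  have h1 : a * x ∈ I ^ 2 := by
    rw [hI, pow_two]
    exact Ideal.mul_mem_mul (aux_le I hI haI) hx
  have h2 : I ^ 2 ≤ Ideal.ofList bs ⊔ Ideal.span {a * a} := by
    generalize Ideal.ofList bs = B at has
    rw [← has, pow_two, Ideal.mul_le]
    intro u hu v hv
    obtain ⟨u1, hu1, u2, hu2, rfl⟩ := Submodule.mem_sup.1 hu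
    obtain ⟨v1, hv1, v2, hv2, rfl⟩ := Submodule.mem_sup.1 hv
    obtain ⟨u3, rfl⟩ := Ideal.mem_span_singleton'.1 hu2
    obtain ⟨v3, rfl⟩ := Ideal.mem_span_singleton'.1 hv2
    refine Submodule.mem_sup.2 ⟨(v1 + v3 * a) * u1 + (u3 * a) * v1,
      B.add_mem (B.mul_mem_left _ hu1) (B.mul_mem_left _ hv1), u3 * v3 * (a * a),
      Ideal.mem_span_singleton'.2 ⟨_, rfl⟩, by ring⟩
  obtain ⟨y, hy, z, hz, hyz⟩ := Submodule.mem_sup.1 (h2 h1)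
  obtain ⟨r, rfl⟩ := Ideal.mem_span_singleton'.1 hz
  have h3 : x - r * a ∈ Ideal.ofList bs • (⊤ : Submodule R R) := by
    refine mem_of_isSMulRegular_quotient_of_smul_mem hreg ?_
    have : a • (x - r * a) = y := by
      rw [smul_eq_mul]; linear_combination -hyz
    rw [this]
    simpa using hy
  have h4 : x - r * a ∈ I := by
    rw [← has]; exact Ideal.mem_sup_left (by simpa using h3)
  have := I.add_mem h4 (I.mul_mem_left r haI)
  simpa using this

end helpers

/-- Let `(R, m)` be a Cohen–Macaulay Noetherian local ring with `dim R > 0`.  Then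
`cs(R) = dim R` if and only if `R` is regular. -/
theorem stmt10 {R : Type*} [CommRing R] [IsLocalRing R] [IsNoetherianRing R]
    (hCM : IsCohenMacaulayLocalRing R) (hdim : 0 < ringKrullDim R) :
    (cs R : WithBot ℕ∞) = ringKrullDim R ↔ IsRegularLocal R := by
  constructor
  · intro h
    obtain ⟨I, hI, hmu⟩ := aux_cs (R := R)
    obtain ⟨s, hs, hsI⟩ := aux_mu I
    have hd : depth R = ((cs R : ℕ) : ℕ∞) := by
      have h2 : (depth R : WithBot ℕ∞) = (cs R : WithBot ℕ∞) := hCM.trans h.symm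
      exact_mod_cast h2
    have hmem : depth R ∈ {n : ℕ∞ | ∃ rs : List R, (rs.length : ℕ∞) = n ∧
        (∀ r ∈ rs, r ∈ maximalIdeal R) ∧ RingTheory.Sequence.IsRegular R rs} := by
      have : Nonempty {n : ℕ∞ | ∃ rs : List R, (rs.length : ℕ∞) = n ∧
          (∀ r ∈ rs, r ∈ maximalIdeal R) ∧ RingTheory.Sequence.IsRegular R rs} :=
        ⟨⟨_, [], rfl, by simp, RingTheory.Sequence.IsRegular.nil R R⟩⟩
      refine ENat.sSup_mem_of_nonempty_of_lt_top ?_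
      change depth R < ⊤
      rw [hd]
      exact ENat.natCast_lt_top _
    obtain ⟨rs, hrl, hrm, hrs⟩ := hmem
    rw [hd] at hrl
    have hrl : rs.length = cs R := by exact_mod_cast hrl
    have hspan : Ideal.ofList s.toList = I := by
      rw [← hsI]
      simp [Ideal.ofList]
    have hcs : 0 < cs R := by
      rw [← h] at hdim
      exact_mod_cast hdim
    have hsl : s.toList.length = cs R := by simp [hs, hmu]
    have hIm : I = maximalIdeal R := by
      refine aux_eq I hI s.toList hspan ?_ ?_
      · intro h0
        rw [h0] at hsl
        simp at hsl
        omega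
      · refine aux_sop s.toList R ?_ ?_ ⟨rs, by rw [hrl, hsl], hrm, hrs.toIsWeaklyRegular⟩
        · intro r hr
          exact aux_le I hI (hspan ▸ Ideal.subset_span hr)
        · intro q hq _ hr
          refine aux_prime I hI q hq ?_
          rw [← hspan]
          exact Ideal.span_le.2 hr
    unfold IsRegularLocal
    rw [← hIm, hmu, h]
  · intro h
    refine le_antisymm ?_ aux_dim_le_cs
    unfold IsRegularLocal at h
    rw [← h]
    have : cs R ≤ mu (maximalIdeal R) := Nat.sInf_le ⟨_, rfl, rfl⟩
    exact_mod_cast this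
end

section
/- Let n and d be integers with 1 ≤ d ≤ n, and define the set of natural numbers S(n, d) = {0, 1, …, d} ∪ {n−d, n−d+1, …, n} ∪ {k·d : k ≥ 1 an integer with d ≤ k·d ≤ n−d}. Then S(n, d) ⊆ {0, 1, …, n} and the sumset S(n, d) + S(n, d) = {s + t : s, t ∈ S(n, d)} equals {0, 1, …, 2n}. -/
/-- The set `S(n, d) = {0, 1, …, d} ∪ {n−d, …, n} ∪ {k·d : k ≥ 1, d ≤ k·d ≤ n−d}`. -/
def Snd (n d : ℕ) : Set ℕ :=
  Set.Icc 0 d ∪ Set.Icc (n - d) n ∪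
    {m : ℕ | ∃ k : ℕ, 1 ≤ k ∧ m = k * d ∧ d ≤ k * d ∧ k * d ≤ n - d}

lemma Snd_lo (n d x : ℕ) (h : x ≤ d) : x ∈ Snd n d :=
  Or.inl (Or.inl ⟨Nat.zero_le _, h⟩)

lemma Snd_hi (n d x : ℕ) (h : n - d ≤ x) (h' : x ≤ n) : x ∈ Snd n d :=
  Or.inl (Or.inr ⟨h, h'⟩)

lemma Snd_mul (n d k : ℕ) (h : k * d ≤ n) : k * d ∈ Snd n d := by
  rcases Nat.eq_zero_or_pos k with rfl | hk
  · exact Snd_lo _ _ _ (by simp)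
  · by_cases h1 : k * d ≤ n - d
    · exact Or.inr ⟨k, hk, rfl, Nat.le_mul_of_pos_left d hk, h1⟩
    · exact Snd_hi _ _ _ (by omega) h

/-- For integers `1 ≤ d ≤ n`, the set `S(n, d)` is contained in `{0, 1, …, n}` and its
sumset `S(n, d) + S(n, d)` equals `{0, 1, …, 2n}`. -/
theorem stmt15 (n d : ℕ) (hd1 : 1 ≤ d) (hdn : d ≤ n) :
    Snd n d ⊆ Set.Icc 0 n ∧
    {x : ℕ | ∃ s ∈ Snd n d, ∃ t ∈ Snd n d, x = s + t} = Set.Icc 0 (2 * n) := by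
  have hsub : Snd n d ⊆ Set.Icc 0 n := by
    rintro x ((⟨_, h⟩ | ⟨_, h⟩) | ⟨k, _, rfl, _, h⟩) <;> exact ⟨Nat.zero_le _, by omega⟩
  refine ⟨hsub, ?_⟩
  ext x
  constructor
  · rintro ⟨s, hs, t, ht, rfl⟩
    have h1 := (hsub hs).2
    have h2 := (hsub ht).2
    exact ⟨Nat.zero_le _, by omega⟩
  · rintro ⟨_, hx⟩
    by_cases hxn : x ≤ n
    · have e := Nat.div_add_mod' x d
      have hr := Nat.mod_lt x hd1
      exact ⟨x / d * d, Snd_mul _ _ _ (by omega), x % d, Snd_lo _ _ _ hr.le, e.symm⟩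
    · have e := Nat.div_add_mod' (x - n) d
      have hr := Nat.mod_lt (x - n) hd1
      have hm : ((x - n) / d + 1) * d = (x - n) / d * d + d := by ring
      by_cases h : ((x - n) / d + 1) * d ≤ n
      · exact ⟨((x - n) / d + 1) * d, Snd_mul _ _ _ h, n - d + (x - n) % d,
          Snd_hi _ _ _ (by omega) (by omega), by omega⟩
      · exact ⟨n, Snd_hi _ _ _ (by omega) le_rfl, x - n,
          Snd_hi _ _ _ (by omega) (by omega), by omega⟩
end
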